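/- (Strong duality) Let $f_0, f_1, \dots, f_m : \mathbb{R}^n \to \mathbb{R}$ be convex functions. Suppose the primal optimal value $p^* = \inf\{ f_0(x) : f_j(x) \le 0, \ j = 1, \dots, m \}$ is finite (i.e., the feasible set is nonempty and $f_0$ is bounded below on it), and that there exists a Slater point $\hat{x}$ with $f_j(\hat{x}) < 0$ for all $j = 1, \dots, m$. Then the dual optimal value equals the primal optimal value and is attained: there exists $\mu^* \in \mathbb{R}^m$ with $\mu^*_j \ge 0$ for all $j$ such that $q(\mu^*) = p^*$, and $q(\mu) \le p^*$ for every $\mu$ with $\mu_j \ge 0$ for all $j$. -/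

import Mathlib

open scoped BigOperators

/-- The Lagrangian `L(x, μ) = f₀(x) + ∑ⱼ μⱼ fⱼ(x)`. -/
noncomputable def lagrangian {n m : ℕ} (f0 : (Fin n → ℝ) → ℝ) (f : Fin m → (Fin n → ℝ) → ℝ)
    (x : Fin n → ℝ) (μ : Fin m → ℝ) : ℝ :=
  f0 x + ∑ j, μ j * f j x

/-- The dual function `q(μ) = inf_x L(x, μ)`, valued in the extended reals. -/
noncomputable def dualFn {n m : ℕ} (f0 : (Fin n → ℝ) → ℝ) (f : Fin m → (Fin n → ℝ) → ℝ)
    (μ : Fin m → ℝ) : EReal :=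
  ⨅ x : Fin n → ℝ, (lagrangian f0 f x μ : EReal)

/-- Strong duality under convexity and Slater's condition. -/
theorem strong_duality {n m : ℕ} (f0 : (Fin n → ℝ) → ℝ) (f : Fin m → (Fin n → ℝ) → ℝ)
    (hf0 : ConvexOn ℝ Set.univ f0) (hf : ∀ j, ConvexOn ℝ Set.univ (f j))
    (pstar : ℝ)
    (hp : IsGLB {y : ℝ | ∃ x : Fin n → ℝ, (∀ j, f j x ≤ 0) ∧ f0 x = y} pstar)
    (slater : ∃ xhat : Fin n → ℝ, ∀ j, f j xhat < 0) :
    ∃ μstar : Fin m → ℝ, (∀ j, 0 ≤ μstar j) ∧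
      dualFn f0 f μstar = (pstar : EReal) ∧
      ∀ μ : Fin m → ℝ, (∀ j, 0 ≤ μ j) → dualFn f0 f μ ≤ (pstar : EReal) := by
  obtain ⟨xh, hxh⟩ := slater
  have weak : ∀ μ : Fin m → ℝ, (∀ j, 0 ≤ μ j) → dualFn f0 f μ ≤ (pstar : EReal) := by
    intro μ hμ
    refine le_of_forall_gt fun r hr => ?_
    obtain ⟨b, hb1, hb2⟩ := EReal.lt_iff_exists_real_btwn.1 hr
    have hb : pstar < b := by exact_mod_cast hb1
    obtain ⟨y, ⟨x, hx, rfl⟩, -, hy⟩ := hp.exists_between hb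
    have hs : ∑ j, μ j * f j x ≤ 0 :=
      Finset.sum_nonpos fun j _ => mul_nonpos_of_nonneg_of_nonpos (hμ j) (hx j)
    have hl : lagrangian f0 f x μ < b := by unfold lagrangian; linarith
    calc dualFn f0 f μ ≤ (lagrangian f0 f x μ : EReal) := iInf_le _ x
      _ < (b : EReal) := by exact_mod_cast hl
      _ < r := hb2
  let A : Set ((Fin m → ℝ) × ℝ) := {a | ∃ x, (∀ j, f j x < a.1 j) ∧ f0 x < a.2}
  have hAo : IsOpen A := by
    have : A = ⋃ x, {a : (Fin m → ℝ) × ℝ | (∀ j, f j x < a.1 j) ∧ f0 x < a.2} := by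
      ext a; simp [A]
    rw [this]
    refine isOpen_iUnion fun x => IsOpen.and ?_ ?_
    · simp only [Set.ofPred_forall]
      exact isOpen_iInter_of_finite fun j => isOpen_lt (by fun_prop) (by fun_prop)
    · exact isOpen_lt (by fun_prop) (by fun_prop)
  have key : ∀ (g : (Fin n → ℝ) → ℝ), ConvexOn ℝ Set.univ g → ∀ (x y : Fin n → ℝ) (s t a b : ℝ),
      g x < s → g y < t → 0 ≤ a → 0 ≤ b → a + b = 1 → g (a • x + b • y) < a * s + b * t := by
    intro g hg x y s t a b h1 h2 ha hb hab
    have h := hg.2 (Set.mem_univ x) (Set.mem_univ y) ha hb hab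
    simp only [smul_eq_mul] at h
    refine h.trans_lt ?_
    rcases ha.eq_or_lt with rfl | ha
    · have : b = 1 := by linarith
      subst this; linarith
    · have := mul_lt_mul_of_pos_left h1 ha
      have := mul_le_mul_of_nonneg_left h2.le hb
      linarith
  have hAc : Convex ℝ A := by
    rintro u ⟨x, hx, hx0⟩ v ⟨y, hy, hy0⟩ a b ha hb hab
    exact ⟨a • x + b • y, fun j => key _ (hf j) _ _ _ _ _ _ (hx j) (hy j) ha hb hab,
      key _ hf0 _ _ _ _ _ _ hx0 hy0 ha hb hab⟩
  have hnot : ((0, pstar) : (Fin m → ℝ) × ℝ) ∉ A := by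
    rintro ⟨x, hx, hx0⟩
    exact absurd (hp.1 ⟨x, fun j => (hx j).le, rfl⟩) (not_le.2 hx0)
  obtain ⟨φ, hφ⟩ := geometric_hahn_banach_point_open hAc hAo hnot
  obtain ⟨c, hc⟩ : ∃ c, c = φ (0, 1) := ⟨_, rfl⟩
  obtain ⟨ν, hν⟩ : ∃ ν : Fin m → ℝ, ν = fun j => φ (Pi.single j 1, 0) := ⟨_, rfl⟩
  have rep : ∀ u t, φ (u, t) = ∑ j, u j * ν j + t * c := by
    intro u t
    have h1 : ((u, t) : (Fin m → ℝ) × ℝ)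
        = ∑ j, u j • ((Pi.single j 1, 0) : (Fin m → ℝ) × ℝ) + t • (0, 1) := by
      ext k
      · simp [Prod.fst_sum, Finset.sum_apply, Pi.single_apply]
      · simp [Prod.snd_sum]
    rw [h1, map_add, map_sum, map_smul, hc, hν]
    simp only [map_smul, smul_eq_mul]
  have sep : ∀ (u : Fin m → ℝ) (t : ℝ) (x : Fin n → ℝ), (∀ j, f j x < u j) → f0 x < t → pstar * c < ∑ j, u j * ν j + t * c := by
    intro u t x h1 h2
    have := hφ (u, t) ⟨x, h1, h2⟩
    rw [rep, rep] at this
    simpa using this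
  have hpx : pstar ≤ f0 xh := hp.1 ⟨xh, fun j => (hxh j).le, rfl⟩
  have hcpos : 0 < c := by
    have := sep 0 (f0 xh + 1) xh (by simpa using hxh) (by linarith)
    simp only [Pi.zero_apply, zero_mul, Finset.sum_const_zero, zero_add] at this
    nlinarith
  have hνn : ∀ j, 0 ≤ ν j := by
    intro j
    by_contra! hj
    have hK : 0 ≤ ((f0 xh + 1) - pstar) * c / (-ν j) :=
      div_nonneg (mul_nonneg (by linarith) hcpos.le) (by linarith)
    have := sep (Pi.single j (((f0 xh + 1) - pstar) * c / (-ν j))) (f0 xh + 1) xh (by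
      intro k
      refine (hxh k).trans_le ?_
      by_cases h : k = j
      · subst h; simpa using hK
      · simp [h]) (by linarith)
    have h2 : ((f0 xh + 1) - pstar) * c / (-ν j) * ν j = -(((f0 xh + 1) - pstar) * c) := by
      have := hj.ne
      field_simp
    simp only [Pi.single_apply, ite_mul, zero_mul, Finset.sum_ite_eq', Finset.sum_ite_eq,
      Finset.mem_univ, if_true] at this
    linarith
  have fin : ∀ x, pstar * c ≤ ∑ j, f j x * ν j + f0 x * c := by
    intro x
    have hS : 0 < ∑ j, ν j + c := add_pos_of_nonneg_of_pos (Finset.sum_nonneg fun j _ => hνn j) hcpos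
    refine le_of_forall_pos_le_add fun δ hδ => ?_
    have he : 0 < δ / (∑ j, ν j + c) := div_pos hδ hS
    have hm : δ / (∑ j, ν j + c) * (∑ j, ν j + c) = δ := div_mul_cancel₀ _ hS.ne'
    generalize δ / (∑ j, ν j + c) = e at he hm
    have := sep (fun j => f j x + e) (f0 x + e) x (fun j => by linarith) (by linarith)
    simp only [add_mul, Finset.sum_add_distrib, ← Finset.mul_sum] at this
    linarith
  have hμ : ∀ j, 0 ≤ ν j / c := fun j => div_nonneg (hνn j) hcpos.le
  refine ⟨fun j => ν j / c, hμ, le_antisymm (weak _ hμ) (le_iInf fun x => ?_), weak⟩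
  have : pstar ≤ lagrangian f0 f x (fun j => ν j / c) := by
    have h := fin x
    have h2 : lagrangian f0 f x (fun j => ν j / c) = (∑ j, f j x * ν j + f0 x * c) / c := by
      unfold lagrangian
      rw [add_div, Finset.sum_div, mul_div_cancel_right₀ _ hcpos.ne', add_comm]
      congr 1
      exact Finset.sum_congr rfl fun j _ => by ring
    rw [h2, le_div_iff₀ hcpos]
    exact h
  exact_mod_cast this
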